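/- arXiv:1607.03805 — 6 statements merged into one kernel-verified Lean document; each statement's English description precedes it below -/
import Mathlib

section
/- Let n ≥ 2 and let 0 ≤ x₁ < x₂ < … < xₙ < 2π be real numbers. Then Σ_{i≠j, 1≤i,j≤n} ( 1/|x_i − x_j| + 1/(2π − |x_i − x_j|) ) ≥ (n²/π) · Σ_{k=1}^{n−1} 1/k, and equality holds when the points are equally spaced, i.e. when x_{i+1} − x_i = 2π/n for all consecutive gaps (including the wrap-around gap). -/
open Real Finset

/-- Sums over ordered pairs of distinct elements of `Fin n`, grouped by cyclic difference. -/
theorem sum_offDiag_fin_eq_sum_cyclic_shift {M : Type*} [AddCommMonoid M] (n : ℕ)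
    (F : ℕ → ℕ → M) :
    ∑ ij ∈ (Finset.univ : Finset (Fin n)).offDiag, F ij.1 ij.2 =
      ∑ k ∈ Finset.Icc 1 (n - 1), ∑ i ∈ Finset.range n,
        F i (if i + k < n then i + k else i + k - n) := by
  rw [← Finset.sum_product']
  refine Finset.sum_bij
    (fun ij _ => (if (ij.1 : ℕ) < ij.2 then (ij.2 : ℕ) - ij.1 else ij.2 + n - ij.1, (ij.1 : ℕ)))
    ?_ ?_ ?_ ?_
  · rintro ⟨⟨i, hi⟩, ⟨j, hj⟩⟩ h
    simp only [mem_offDiag, mem_univ, true_and, ne_eq, Fin.mk.injEq] at h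
    simp only [mem_product, mem_Icc, mem_range]
    split_ifs <;> omega
  · rintro ⟨⟨i, hi⟩, ⟨j, hj⟩⟩ h ⟨⟨i', hi'⟩, ⟨j', hj'⟩⟩ h' heq
    simp only [mem_offDiag, mem_univ, true_and, ne_eq, Fin.mk.injEq] at h h'
    simp only [Prod.mk.injEq, Fin.mk.injEq] at heq ⊢
    obtain ⟨h1, rfl⟩ := heq
    split_ifs at h1 <;> omega
  · rintro ⟨k, i⟩ h
    simp only [mem_product, mem_Icc, mem_range] at h
    refine ⟨(⟨i, h.2⟩, ⟨if i + k < n then i + k else i + k - n, by split_ifs <;> omega⟩), ?_, ?_⟩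
    · simp only [mem_offDiag, mem_univ, true_and, ne_eq, Fin.mk.injEq]
      split_ifs <;> omega
    · simp only [Prod.mk.injEq, and_true]
      split_ifs <;> omega
  · rintro ⟨⟨i, hi⟩, ⟨j, hj⟩⟩ h
    simp only [mem_offDiag, mem_univ, true_and, ne_eq, Fin.mk.injEq] at h
    dsimp only
    congr 1
    split_ifs <;> omega

theorem sum_range_shift_sub {n k : ℕ} {c : ℝ} {y : ℕ → ℝ}
    (hy : ∀ i < k, y (i + n) = y i + c) :
    ∑ i ∈ Finset.range n, (y (i + k) - y i) = k * c := by
  induction k with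
  | zero => simp
  | succ k ih =>
    have ih := ih fun i hi => hy i (by omega)
    have htel := Finset.sum_range_sub (fun i => y (i + k)) n
    have hk := hy k (by omega)
    simp only [Finset.sum_sub_distrib, zero_add] at ih htel ⊢
    rw [Nat.add_comm n k, hk] at htel
    have hshift : ∑ i ∈ Finset.range n, y (i + (k + 1)) =
        ∑ i ∈ Finset.range n, y (i + 1 + k) :=
      Finset.sum_congr rfl fun i _ => by congr 1; omega
    rw [hshift]
    push_cast
    linarith

theorem card_sq_div_sum_le_sum_one_div {ι : Type*} (s : Finset ι) {a : ι → ℝ}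
    (ha : ∀ i ∈ s, 0 < a i) :
    (s.card : ℝ) ^ 2 / ∑ i ∈ s, a i ≤ ∑ i ∈ s, 1 / a i := by
  simpa using Finset.sq_sum_div_le_sum_sq_div s (fun _ => (1 : ℝ)) ha

theorem sum_Icc_one_div_sub (n : ℕ) :
    ∑ k ∈ Finset.Icc 1 (n - 1), (1 : ℝ) / (n - k) = ∑ k ∈ Finset.Icc 1 (n - 1), (1 : ℝ) / k := by
  refine Finset.sum_bij (fun k _ => n - k) ?_ ?_ ?_ ?_
  · intro k hk
    simp only [mem_Icc] at hk ⊢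
    omega
  · intro k hk l hl h
    simp only [mem_Icc] at hk hl
    omega
  · intro k hk
    simp only [mem_Icc] at hk
    exact ⟨n - k, by simp only [mem_Icc]; omega, by omega⟩
  · intro k hk
    simp only [mem_Icc] at hk
    rw [Nat.cast_sub (by omega)]

theorem sq_div_pi_mul_sum_one_div (n : ℕ) :
    (n : ℝ) ^ 2 / π * ∑ k ∈ Finset.Icc 1 (n - 1), (1 : ℝ) / k =
      ∑ k ∈ Finset.Icc 1 (n - 1),
        ((n : ℝ) ^ 2 / (k * (2 * π)) + (n : ℝ) ^ 2 / ((n - k) * (2 * π))) := by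
  have h : ∀ c : ℝ, (n : ℝ) ^ 2 / (c * (2 * π)) = (n : ℝ) ^ 2 / (2 * π) * (1 / c) := by
    intro c
    rw [div_mul_div_comm, mul_one, mul_comm c]
  simp only [h]
  rw [Finset.sum_add_distrib, ← Finset.mul_sum, ← Finset.mul_sum, sum_Icc_one_div_sub]
  field_simp
  ring

/-- The sum over pairs of points on the circle, in terms of the forward arcs of a lift `y` of the
points to the line. -/
theorem sum_offDiag_eq_sum_arcs {n : ℕ} {x : Fin n → ℝ} {y : ℕ → ℝ}
    (hlow : ∀ i : Fin n, y i = x i) (hper : ∀ i < n, y (i + n) = y i + 2 * π)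
    (hpos : ∀ i < n, ∀ k, 0 < k → k < n → 0 < y (i + k) - y i ∧ y (i + k) - y i < 2 * π) :
    ∑ ij ∈ (Finset.univ : Finset (Fin n)).offDiag,
        (1 / |x ij.1 - x ij.2| + 1 / (2 * π - |x ij.1 - x ij.2|)) =
      ∑ k ∈ Finset.Icc 1 (n - 1), ∑ i ∈ Finset.range n,
        (1 / (y (i + k) - y i) + 1 / (2 * π - (y (i + k) - y i))) := by
  simp only [← hlow]
  rw [sum_offDiag_fin_eq_sum_cyclic_shift n
    fun i j => 1 / |y i - y j| + 1 / (2 * π - |y i - y j|)]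
  refine Finset.sum_congr rfl fun k hk => Finset.sum_congr rfl fun i hi => ?_
  simp only [mem_Icc, mem_range] at hk hi
  obtain ⟨h1, h2⟩ := hpos i hi k (by omega) (by omega)
  split_ifs with h
  · rw [abs_sub_comm, abs_of_pos h1]
  · have hp := hper (i + k - n) (by omega)
    rw [Nat.sub_add_cancel (by omega)] at hp
    have habs : |y i - y (i + k - n)| = 2 * π - (y (i + k) - y i) := by
      rw [abs_of_pos (by linarith)]
      linarith
    rw [habs, sub_sub_cancel, add_comm]

theorem exists_lift_to_line {n : ℕ} {x : Fin n → ℝ} (hmono : StrictMono x)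
    (hspread : ∀ i j, x i < x j + 2 * π) :
    ∃ y : ℕ → ℝ, (∀ i : Fin n, y i = x i) ∧ (∀ i < n, y (i + n) = y i + 2 * π) ∧
      ∀ i < n, ∀ k, 0 < k → k < n → 0 < y (i + k) - y i ∧ y (i + k) - y i < 2 * π := by
  let z : ℕ → ℝ := fun m => if h : m < n then x ⟨m, h⟩ else 0
  have hz : ∀ m (h : m < n), z m = x ⟨m, h⟩ := fun m h => dif_pos h
  let y : ℕ → ℝ := fun m => if m < n then z m else z (m - n) + 2 * π
  have hylt : ∀ m (h : m < n), y m = x ⟨m, h⟩ := fun m h => (if_pos h).trans (hz m h)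
  have hyge : ∀ m (h : n ≤ m) (h' : m - n < n), y m = x ⟨m - n, h'⟩ + 2 * π :=
    fun m h h' => (if_neg h.not_gt).trans (by rw [hz _ h'])
  refine ⟨y, fun i => hylt i i.2, fun i hi => ?_, fun i hi k hk hkn => ?_⟩
  · rw [hyge _ (by omega) (by omega), hylt i hi]
    simp
  · rw [hylt i hi]
    by_cases h : i + k < n
    · rw [hylt _ h]
      have h1 := hmono (show (⟨i, hi⟩ : Fin n) < ⟨i + k, h⟩ from Fin.mk_lt_mk.2 (by omega))
      have h2 := hspread ⟨i + k, h⟩ ⟨i, hi⟩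
      constructor <;> linarith
    · have h' : i + k - n < n := by omega
      rw [hyge _ (by omega) h']
      have h1 := hmono (show (⟨i + k - n, h'⟩ : Fin n) < ⟨i, hi⟩ from Fin.mk_lt_mk.2 (by omega))
      have h2 := hspread ⟨i, hi⟩ ⟨i + k - n, h'⟩
      constructor <;> linarith



/-- For `n ≥ 2` and `0 ≤ x₁ < x₂ < … < xₙ < 2π`, the sum over ordered
pairs `i ≠ j` of `1/|xᵢ - xⱼ| + 1/(2π - |xᵢ - xⱼ|)` is at least `(n²/π) ∑_{k=1}^{n-1} 1/k`,
with equality when the points are equally spaced. -/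
theorem circle_gap_inequality (n : ℕ) (hn : 2 ≤ n) (x : Fin n → ℝ)
    (hmono : StrictMono x) (h0 : 0 ≤ x ⟨0, by omega⟩) (h2pi : ∀ i, x i < 2 * π) :
    (n : ℝ) ^ 2 / π * ∑ k ∈ Finset.Icc 1 (n - 1), (1 : ℝ) / k ≤
      (∑ ij ∈ (Finset.univ : Finset (Fin n)).offDiag,
        (1 / |x ij.1 - x ij.2| + 1 / (2 * π - |x ij.1 - x ij.2|))) ∧
    ((∀ i : Fin n, x i = x ⟨0, by omega⟩ + ((i : ℕ) : ℝ) * (2 * π / n)) →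
      (∑ ij ∈ (Finset.univ : Finset (Fin n)).offDiag,
        (1 / |x ij.1 - x ij.2| + 1 / (2 * π - |x ij.1 - x ij.2|))) =
      (n : ℝ) ^ 2 / π * ∑ k ∈ Finset.Icc 1 (n - 1), (1 : ℝ) / k) := by
  have hspread : ∀ i j, x i < x j + 2 * π := fun i j => by
    have := hmono.monotone (show (⟨0, by omega⟩ : Fin n) ≤ j from Nat.zero_le _)
    linarith [h2pi i]
  obtain ⟨y, hlow, hper, hpos⟩ := exists_lift_to_line hmono hspread
  rw [sum_offDiag_eq_sum_arcs hlow hper hpos, sq_div_pi_mul_sum_one_div]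
  refine ⟨Finset.sum_le_sum fun k hk => ?_, fun heq => Finset.sum_congr rfl fun k hk => ?_⟩
  · simp only [mem_Icc] at hk
    have hS := sum_range_shift_sub (k := k) fun i hi => hper i (by omega)
    have hS' : ∑ i ∈ Finset.range n, (2 * π - (y (i + k) - y i)) = (n - k) * (2 * π) := by
      rw [Finset.sum_sub_distrib, hS, sum_const, card_range, nsmul_eq_mul]
      ring
    have harc : ∀ i ∈ Finset.range n, 0 < y (i + k) - y i ∧ y (i + k) - y i < 2 * π :=
      fun i hi => hpos i (mem_range.1 hi) k (by omega) (by omega)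
    have h1 := card_sq_div_sum_le_sum_one_div _ fun i hi => (harc i hi).1
    have h2 := card_sq_div_sum_le_sum_one_div _ fun i hi => sub_pos.2 (harc i hi).2
    rw [hS, card_range] at h1
    rw [hS', card_range] at h2
    rw [Finset.sum_add_distrib]
    exact add_le_add h1 h2
  · simp only [mem_Icc] at hk
    have hn0 : (n : ℝ) ≠ 0 := by positivity
    have hylt : ∀ m < n, y m = x ⟨0, by omega⟩ + m * (2 * π / n) := fun m hm =>
      (hlow ⟨m, hm⟩).trans (heq ⟨m, hm⟩)
    have harc : ∀ i ∈ Finset.range n, y (i + k) - y i = k * (2 * π) / n := by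
      intro i hi
      rw [mem_range] at hi
      by_cases h : i + k < n
      · rw [hylt _ h, hylt i hi]
        push_cast
        ring
      · obtain ⟨m, hm⟩ := Nat.exists_eq_add_of_le' (not_lt.1 h)
        have hc : (i : ℝ) + k = m + n := by exact_mod_cast hm
        rw [hm, hper m (by omega), hylt m (by omega), hylt i hi, eq_sub_of_add_eq' hc]
        field_simp
        ring
    have hk' : 2 * π - k * (2 * π) / n = (n - k) * (2 * π) / n := by
      field_simp
    rw [Finset.sum_congr rfl fun i hi => by rw [harc i hi], sum_const, card_range, nsmul_eq_mul,
      hk', one_div_div, one_div_div]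
    ring
end

section
/- There exists a constant c > 0 such that for every n ≥ 2 and every collection of n pairwise non-parallel lines ℓ₁, …, ℓₙ in ℝ² with (1/n)-neighborhoods T₁, …, Tₙ, one has Σ_{i≠j, 1≤i,j≤n} |T_i ∩ T_j| ≥ c · log n. -/
open MeasureTheory Finset

/-- A line in the plane: the set of points `p + t • v` with `v ≠ 0`. -/
def IsLine (L : Set (EuclideanSpace ℝ (Fin 2))) : Prop :=
  ∃ p v : EuclideanSpace ℝ (Fin 2), v ≠ 0 ∧ L = {x | ∃ t : ℝ, x = p + t • v}

/-- The `r`-neighborhood of a set in the plane. -/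
def lineNbhd (L : Set (EuclideanSpace ℝ (Fin 2))) (r : ℝ) : Set (EuclideanSpace ℝ (Fin 2)) :=
  {x | Metric.infDist x L ≤ r}

/-- Among pairs of indices, at least a proportion `1 / M` fall in the same class of a partition
into `M` classes. -/
theorem card_sq_le_mul_card_filter_eq {ι κ : Type*} [Fintype ι] [DecidableEq κ]
    (s : Finset κ) (g : ι → κ) (hg : ∀ i, g i ∈ s) :
    Fintype.card ι ^ 2 ≤ #s * #{p : ι × ι | g p.1 = g p.2} := by
  have hι : Fintype.card ι = ∑ k ∈ s, #{i | g i = k} :=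
    Finset.card_eq_sum_card_fiberwise fun i _ => hg i
  have hpairs : #{p : ι × ι | g p.1 = g p.2} = ∑ k ∈ s, #{i | g i = k} ^ 2 := by
    rw [Finset.card_eq_sum_card_fiberwise (f := fun p : ι × ι => g p.1) (t := s)
      fun p _ => hg p.1]
    refine Finset.sum_congr rfl fun k _ => ?_
    rw [sq, ← Finset.card_product]
    congr 1
    ext p
    simp only [Finset.mem_filter, Finset.mem_univ, true_and, Finset.mem_product]
    grind
  rw [hι, hpairs]
  exact sq_sum_le_card_mul_sum_sq

/-- If `n` numbers lie in `(0, 1]`, at least `n² / M - n` ordered pairs of distinct indices are at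
distance at most `1 / M`. -/
theorem card_offDiag_dist_le {ι : Type*} [Fintype ι] [DecidableEq ι] (u : ι → ℝ)
    (hu : ∀ i, u i ∈ Set.Ioc 0 1) {M : ℕ} (hM : 0 < M) :
    (Fintype.card ι : ℝ) ^ 2 * (M : ℝ)⁻¹ - Fintype.card ι ≤
      #{p ∈ (univ : Finset ι).offDiag | |u p.1 - u p.2| * M ≤ 1} := by
  have hM' : (0 : ℝ) < M := by exact_mod_cast hM
  have hcell := card_sq_le_mul_card_filter_eq (Finset.Icc 1 M) (fun i => ⌈u i * M⌉₊) fun i => by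
    obtain ⟨h0, h1⟩ := hu i
    rw [Finset.mem_Icc, Nat.one_le_ceil_iff, Nat.ceil_le]
    exact ⟨by positivity, by nlinarith⟩
  have hsub : ({p : ι × ι | ⌈u p.1 * M⌉₊ = ⌈u p.2 * M⌉₊} : Finset (ι × ι)) ⊆
      {p ∈ (univ : Finset ι).offDiag | |u p.1 - u p.2| * M ≤ 1} ∪ (univ : Finset ι).diag := by
    rintro ⟨i, j⟩ h
    simp only [Finset.mem_filter, Finset.mem_univ, true_and] at h
    simp only [Finset.mem_union, Finset.mem_filter, Finset.mem_offDiag, Finset.mem_diag,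
      Finset.mem_univ, true_and]
    by_cases hij : i = j
    · exact Or.inr hij
    refine Or.inl ⟨hij, ?_⟩
    have hi := Nat.le_ceil (u i * M)
    have hj := Nat.le_ceil (u j * M)
    have hi' := Nat.ceil_lt_add_one (mul_nonneg (hu i).1.le hM'.le)
    have hj' := Nat.ceil_lt_add_one (mul_nonneg (hu j).1.le hM'.le)
    rw [h] at hi hi'
    rw [← Nat.abs_cast M, ← abs_mul, abs_le]
    constructor <;> linarith
  have hcard := (Finset.card_le_card hsub).trans (Finset.card_union_le _ _)
  rw [Finset.diag_card, Finset.card_univ] at hcard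
  rw [Nat.card_Icc, Nat.add_sub_cancel] at hcell
  have h := hcell.trans (Nat.mul_le_mul_left M hcard)
  rw [sub_le_iff_le_add, ← div_eq_mul_inv, div_le_iff₀ hM']
  rw [mul_comm]
  exact_mod_cast h

theorem card_filter_mul_le_one_le_inv {d : ℝ} (hd : 0 < d) (n : ℕ) :
    (#((Finset.Icc 1 n).filter fun M : ℕ => d * M ≤ 1) : ℝ) ≤ d⁻¹ := by
  have hsub : ((Finset.Icc 1 n).filter fun M : ℕ => d * M ≤ 1) ⊆ Finset.Icc 1 ⌊d⁻¹⌋₊ := by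
    intro M hM
    rw [Finset.mem_filter, Finset.mem_Icc] at hM
    rw [Finset.mem_Icc, Nat.le_floor_iff (by positivity), ← one_div, le_div_iff₀ hd]
    exact ⟨hM.1.1, by linarith⟩
  have hcard := Finset.card_le_card hsub
  rw [Nat.card_Icc, Nat.add_sub_cancel] at hcard
  exact (Nat.cast_le.2 hcard).trans (Nat.floor_le (by positivity))

/-- Lower bound for the Riesz `1`-energy of `n` distinct points of `(0, 1]`. -/
theorem sq_mul_harmonic_sub_one_le_sum_inv {ι : Type*} [Fintype ι] [DecidableEq ι] (u : ι → ℝ)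
    (hu : ∀ i, u i ∈ Set.Ioc 0 1) (hinj : Function.Injective u) :
    (Fintype.card ι : ℝ) ^ 2 * (harmonic (Fintype.card ι) - 1) ≤
      ∑ p ∈ (univ : Finset ι).offDiag, |u p.1 - u p.2|⁻¹ := by
  set n := Fintype.card ι
  calc (n : ℝ) ^ 2 * (harmonic n - 1)
      = ∑ M ∈ Finset.Icc 1 n, ((n : ℝ) ^ 2 * (M : ℝ)⁻¹ - n) := by
        rw [Finset.sum_sub_distrib, ← Finset.mul_sum, harmonic_eq_sum_Icc]
        simp only [Finset.sum_const, Nat.card_Icc, Nat.add_sub_cancel, nsmul_eq_mul]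
        push_cast
        ring
    _ ≤ ∑ M ∈ Finset.Icc 1 n,
          (#{p ∈ (univ : Finset ι).offDiag | |u p.1 - u p.2| * M ≤ 1} : ℝ) :=
        Finset.sum_le_sum fun M hM =>
          card_offDiag_dist_le u hu (Finset.mem_Icc.1 hM).1
    _ = ∑ p ∈ (univ : Finset ι).offDiag,
          (#((Finset.Icc 1 n).filter fun M : ℕ => |u p.1 - u p.2| * M ≤ 1) : ℝ) := by
        exact_mod_cast Finset.sum_card_bipartiteAbove_eq_sum_card_bipartiteBelow
          (s := Finset.Icc 1 n) (t := (univ : Finset ι).offDiag)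
          fun (M : ℕ) (p : ι × ι) => |u p.1 - u p.2| * (M : ℝ) ≤ 1
    _ ≤ ∑ p ∈ (univ : Finset ι).offDiag, |u p.1 - u p.2|⁻¹ :=
        Finset.sum_le_sum fun p hp => card_filter_mul_le_one_le_inv
          (abs_pos.2 (sub_ne_zero.2 (hinj.ne (Finset.mem_offDiag.1 hp).2.2))) n

theorem log_le_three_mul_harmonic_sub_one {n : ℕ} (hn : 2 ≤ n) :
    Real.log n ≤ 3 * ((harmonic n : ℝ) - 1) := by
  have hlog : Real.log n ≤ harmonic n :=
    (Real.log_le_log (by positivity) (by push_cast; linarith)).trans (log_add_one_le_harmonic n)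
  have hharm : (3 / 2 : ℝ) ≤ harmonic n := by
    have h : harmonic 2 ≤ harmonic n :=
      Finset.sum_le_sum_of_subset_of_nonneg (Finset.range_mono hn) fun _ _ _ => by positivity
    have h2 : harmonic 2 = 3 / 2 := by norm_num [harmonic, Finset.sum_range_succ]
    rw [h2] at h
    simpa using (Rat.cast_le (K := ℝ)).2 h
  linarith

/-- Every line has an equation whose normal is a unit vector. -/
theorem IsLine.exists_eq_setOf {L : Set (EuclideanSpace ℝ (Fin 2))} (hL : IsLine L) :
    ∃ θ ∈ Set.Ioc (-Real.pi) Real.pi, ∃ a : ℝ,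
      L = {x | -Real.sin θ * x 0 + Real.cos θ * x 1 = a} := by
  obtain ⟨p, v, hv, rfl⟩ := hL
  set z : ℂ := ⟨v 0, v 1⟩ with hz
  have hz0 : z ≠ 0 := by
    intro h
    apply hv
    ext i
    fin_cases i
    · exact congrArg Complex.re h
    · exact congrArg Complex.im h
  have hr : ‖z‖ ≠ 0 := norm_ne_zero_iff.2 hz0
  have h0 : v 0 = ‖z‖ * Real.cos z.arg := (Complex.norm_mul_cos_arg z).symm
  have h1 : v 1 = ‖z‖ * Real.sin z.arg := (Complex.norm_mul_sin_arg z).symm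
  refine ⟨z.arg, Complex.arg_mem_Ioc z, -Real.sin z.arg * p 0 + Real.cos z.arg * p 1, ?_⟩
  have hsc := Real.sin_sq_add_cos_sq z.arg
  generalize ‖z‖ = r at *
  generalize Real.sin z.arg = s at *
  generalize Real.cos z.arg = c at *
  ext x
  simp only [Set.mem_ofPred_eq]
  constructor
  · rintro ⟨t, rfl⟩
    simp only [PiLp.add_apply, PiLp.smul_apply, smul_eq_mul, h0, h1]
    ring
  · intro hx
    refine ⟨(c * (x 0 - p 0) + s * (x 1 - p 1)) / r, ?_⟩
    ext i
    fin_cases i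
    · simp only [Fin.zero_eta, PiLp.add_apply, PiLp.smul_apply, smul_eq_mul, h0]
      field_simp
      linear_combination (-s) * hx - (x 0 - p 0) * hsc
    · simp only [Fin.mk_one, PiLp.add_apply, PiLp.smul_apply, smul_eq_mul, h1]
      field_simp
      linear_combination c * hx - (x 1 - p 1) * hsc

theorem infDist_setOf_normal_eq (θ a : ℝ) (x : EuclideanSpace ℝ (Fin 2)) :
    Metric.infDist x {y | -Real.sin θ * y 0 + Real.cos θ * y 1 = a} =
      |-Real.sin θ * x 0 + Real.cos θ * x 1 - a| := by
  have hsc := Real.sin_sq_add_cos_sq θ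
  generalize Real.sin θ = s at *
  generalize Real.cos θ = c at *
  set b := -s * x 0 + c * x 1 - a with hb
  have hfoot : !₂[x 0 + b * s, x 1 - b * c] ∈
      {y : EuclideanSpace ℝ (Fin 2) | -s * y 0 + c * y 1 = a} := by
    simp
    linear_combination -b * hsc + hb
  apply le_antisymm
  · refine (Metric.infDist_le_dist_of_mem hfoot).trans_eq ?_
    rw [EuclideanSpace.dist_eq, ← Real.sqrt_sq_eq_abs]
    congr 1
    simp [Fin.sum_univ_two, Real.dist_eq, sq_abs]
    linear_combination b ^ 2 * hsc
  · rw [Metric.le_infDist ⟨_, hfoot⟩]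
    intro y hy
    rw [EuclideanSpace.dist_eq]
    apply Real.abs_le_sqrt
    simp only [Fin.sum_univ_two, Real.dist_eq, sq_abs]
    have hy' : -s * y 0 + c * y 1 = a := hy
    have hb' : b = -s * (x 0 - y 0) + c * (x 1 - y 1) := by linear_combination hb + hy'
    rw [hb']
    nlinarith [sq_nonneg (c * (x 0 - y 0) + s * (x 1 - y 1))]

/-- The intersection of two strips of half-width `r` at angle `φ - θ` is a rhombus of area
`(2 * r) ^ 2 / |sin (φ - θ)|`. -/
theorem volume_strip_inter_strip {θ φ : ℝ} (h : Real.sin (φ - θ) ≠ 0) (a b : ℝ) {r : ℝ}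
    (hr : 0 ≤ r) :
    (volume {x : EuclideanSpace ℝ (Fin 2) |
      |-Real.sin θ * x 0 + Real.cos θ * x 1 - a| ≤ r ∧
        |-Real.sin φ * x 0 + Real.cos φ * x 1 - b| ≤ r}).toReal =
      (2 * r) ^ 2 * |Real.sin (φ - θ)|⁻¹ := by
  set A : Matrix (Fin 2) (Fin 2) ℝ :=
    !![-Real.sin θ, Real.cos θ; -Real.sin φ, Real.cos φ] with hA
  have hdet : LinearMap.det (Matrix.toLin' A) = Real.sin (φ - θ) := by
    rw [LinearMap.det_toLin', hA, Matrix.det_fin_two_of, Real.sin_sub]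
    ring
  have hset : {x : EuclideanSpace ℝ (Fin 2) |
      |-Real.sin θ * x 0 + Real.cos θ * x 1 - a| ≤ r ∧
        |-Real.sin φ * x 0 + Real.cos φ * x 1 - b| ≤ r} =
      WithLp.ofLp ⁻¹' (Matrix.toLin' A ⁻¹' Set.Icc ![a - r, b - r] ![a + r, b + r]) := by
    ext x
    simp only [Set.mem_ofPred_eq, Set.mem_preimage, Set.mem_Icc, Pi.le_def, Fin.forall_fin_two,
      abs_le, Matrix.toLin'_apply, hA, Matrix.mulVec, dotProduct, Fin.sum_univ_two]
    simp
    constructor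
    · rintro ⟨⟨h1, h2⟩, h3, h4⟩
      exact ⟨⟨by linarith, by linarith⟩, by linarith, by linarith⟩
    · rintro ⟨⟨h1, h2⟩, h3, h4⟩
      exact ⟨⟨by linarith, by linarith⟩, by linarith, by linarith⟩
  rw [hset, (PiLp.volume_preserving_ofLp (Fin 2)).measure_preimage
      (measurableSet_Icc.preimage (LinearMap.continuous_of_finiteDimensional _).measurable
        ).nullMeasurableSet,
    Measure.addHaar_preimage_linearMap _ (by rwa [hdet]), hdet, Real.volume_Icc_pi]
  simp only [Fin.prod_univ_two, ENNReal.toReal_mul]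
  rw [ENNReal.toReal_ofReal (abs_nonneg _)]
  simp [abs_inv]
  rw [ENNReal.toReal_ofReal (by positivity)]
  ring

theorem sin_sub_ne_zero_of_existsUnique {θ φ a b : ℝ}
    (h : ∃! x : EuclideanSpace ℝ (Fin 2),
      x ∈ {y : EuclideanSpace ℝ (Fin 2) | -Real.sin θ * y 0 + Real.cos θ * y 1 = a} ∩
        {y | -Real.sin φ * y 0 + Real.cos φ * y 1 = b}) :
    Real.sin (φ - θ) ≠ 0 := by
  intro hs
  obtain ⟨x, ⟨hx1, hx2⟩, hx⟩ := h
  simp only [Set.mem_ofPred_eq] at hx1 hx2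
  rw [Real.sin_sub] at hs
  have hy := hx (!₂[x 0 + Real.cos θ, x 1 + Real.sin θ]) ⟨by simp; linear_combination hx1,
    by simp; linear_combination hx2 - hs⟩
  have h0 : x 0 + Real.cos θ = x 0 := congrArg (fun z => z 0) hy
  have h1 : x 1 + Real.sin θ = x 1 := congrArg (fun z => z 1) hy
  have hsc := Real.sin_sq_add_cos_sq θ
  rw [add_eq_left.1 h0, add_eq_left.1 h1] at hsc
  norm_num at hsc

theorem abs_inv_le_abs_sin_inv {x : ℝ} (h : Real.sin x ≠ 0) : |x|⁻¹ ≤ |Real.sin x|⁻¹ :=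
  inv_anti₀ (abs_pos.2 h) Real.abs_sin_le_abs

/-- There is `c > 0` such that for any `n ≥ 2` pairwise non-parallel lines
in `ℝ²` with `(1/n)`-neighborhoods `T₁, …, Tₙ`, one has `∑_{i ≠ j} |Tᵢ ∩ Tⱼ| ≥ c log n`. -/
theorem overlap_lines_lower_bound_s_eq_one :
    ∃ c : ℝ, 0 < c ∧ ∀ n : ℕ, 2 ≤ n →
      ∀ L : Fin n → Set (EuclideanSpace ℝ (Fin 2)),
        (∀ i, IsLine (L i)) →
        (∀ i j, i ≠ j → ∃! x, x ∈ L i ∩ L j) →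
        c * Real.log n ≤
          ∑ ij ∈ (Finset.univ : Finset (Fin n)).offDiag,
            (volume (lineNbhd (L ij.1) (1 / n) ∩ lineNbhd (L ij.2) (1 / n))).toReal := by
  refine ⟨2 / (3 * Real.pi), by positivity, fun n hn L hL hLL => ?_⟩
  choose θ hθ a ha using fun i => (hL i).exists_eq_setOf
  have hsin : ∀ i j, i ≠ j → Real.sin (θ j - θ i) ≠ 0 := fun i j hij =>
    sin_sub_ne_zero_of_existsUnique (a := a i) (b := a j) (by
      rw [← ha i, ← ha j]
      exact hLL i j hij)
  have hn0 : (0 : ℝ) < n := by positivity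
  have hπ := Real.pi_pos
  set u : Fin n → ℝ := fun i => (θ i + Real.pi) / (2 * Real.pi) with hu
  have hu_mem : ∀ i, u i ∈ Set.Ioc 0 1 := fun i => by
    obtain ⟨h1, h2⟩ := hθ i
    exact ⟨div_pos (by linarith) (by positivity), (div_le_one (by positivity)).2 (by linarith)⟩
  have hu_sub : ∀ i j, u i - u j = (θ i - θ j) / (2 * Real.pi) := fun i j => by
    simp only [hu]
    ring
  have hu_inj : Function.Injective u := fun i j hij => by
    by_contra hne
    have h := hu_sub j i
    rw [hij, sub_self, eq_comm, div_eq_zero_iff, or_iff_left (by positivity)] at h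
    exact hsin i j hne (by rw [h, Real.sin_zero])
  have henergy := sq_mul_harmonic_sub_one_le_sum_inv u hu_mem hu_inj
  rw [Fintype.card_fin] at henergy
  calc 2 / (3 * Real.pi) * Real.log n
      ≤ 2 / (3 * Real.pi) * (3 * ((harmonic n : ℝ) - 1)) := by
        gcongr
        exact log_le_three_mul_harmonic_sub_one hn
    _ = 2 / (Real.pi * n ^ 2) * ((n : ℝ) ^ 2 * (harmonic n - 1)) := by field_simp
    _ ≤ 2 / (Real.pi * n ^ 2) * ∑ p ∈ (univ : Finset (Fin n)).offDiag, |u p.1 - u p.2|⁻¹ := by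
        gcongr
    _ ≤ _ := by
        rw [Finset.mul_sum]
        refine Finset.sum_le_sum fun p hp => ?_
        have hs := hsin p.1 p.2 (Finset.mem_offDiag.1 hp).2.2
        have hvol := volume_strip_inter_strip hs (a p.1) (a p.2) (r := 1 / n) (by positivity)
        have hset : lineNbhd (L p.1) (1 / n) ∩ lineNbhd (L p.2) (1 / n) =
            {x : EuclideanSpace ℝ (Fin 2) |
              |-Real.sin (θ p.1) * x 0 + Real.cos (θ p.1) * x 1 - a p.1| ≤ 1 / n ∧
                |-Real.sin (θ p.2) * x 0 + Real.cos (θ p.2) * x 1 - a p.2| ≤ 1 / n} := by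
          rw [ha p.1, ha p.2]
          simp only [lineNbhd, infDist_setOf_normal_eq]
          rfl
        rw [hset, hvol]
        calc 2 / (Real.pi * n ^ 2) * |u p.1 - u p.2|⁻¹
            = (2 * (1 / (n : ℝ))) ^ 2 * |θ p.2 - θ p.1|⁻¹ := by
              rw [abs_sub_comm, hu_sub, abs_div, abs_of_pos (by positivity : 0 < 2 * Real.pi),
                inv_div]
              field_simp
          _ ≤ _ := by
              exact mul_le_mul_of_nonneg_left (abs_inv_le_abs_sin_inv hs) (by positivity)
end

section
/- There exists a constant c > 0 such that for every n ≥ 1 there exist points p₁, …, pₙ on the unit sphere S² ⊂ ℝ³ satisfying ‖p_i − p_j‖ ≥ c/√n and ‖p_i + p_j‖ ≥ c/√n for all i ≠ j (equivalently, min over all sign choices of ‖±p_i ± p_j‖ ≥ c/√n for i ≠ j). -/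
open Metric

/-- The point of the closed upper unit hemisphere above `(x, y)`. -/
noncomputable def hemispherePoint (x y : ℝ) : EuclideanSpace ℝ (Fin 3) :=
  !₂[x, y, Real.sqrt (1 - x ^ 2 - y ^ 2)]

lemma norm_hemispherePoint {x y : ℝ} (h : x ^ 2 + y ^ 2 ≤ 1) : ‖hemispherePoint x y‖ = 1 := by
  have hz : 0 ≤ 1 - x ^ 2 - y ^ 2 := by linarith
  simp [hemispherePoint, EuclideanSpace.norm_eq, Fin.sum_univ_three, Real.sq_sqrt hz]

lemma abs_sub_le_norm_hemispherePoint_sub (x y x' y' : ℝ) :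
    |x - x'| ≤ ‖hemispherePoint x y - hemispherePoint x' y'‖ ∧
      |y - y'| ≤ ‖hemispherePoint x y - hemispherePoint x' y'‖ := by
  constructor
  · simpa [hemispherePoint] using
      PiLp.norm_apply_le (hemispherePoint x y - hemispherePoint x' y') 0
  · simpa [hemispherePoint] using
      PiLp.norm_apply_le (hemispherePoint x y - hemispherePoint x' y') 1

lemma one_le_norm_hemispherePoint_add {x y x' y' : ℝ} (h : x ^ 2 + y ^ 2 ≤ 1 / 2)
    (h' : x' ^ 2 + y' ^ 2 ≤ 1 / 2) :
    1 ≤ ‖hemispherePoint x y + hemispherePoint x' y'‖ := by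
  have hz : 1 / 2 ≤ Real.sqrt (1 - x ^ 2 - y ^ 2) := Real.le_sqrt_of_sq_le (by linarith)
  have hz' : 1 / 2 ≤ Real.sqrt (1 - x' ^ 2 - y' ^ 2) := Real.le_sqrt_of_sq_le (by linarith)
  have key : |Real.sqrt (1 - x ^ 2 - y ^ 2) + Real.sqrt (1 - x' ^ 2 - y' ^ 2)| ≤
      ‖hemispherePoint x y + hemispherePoint x' y'‖ := by
    simpa [hemispherePoint] using
      PiLp.norm_apply_le (hemispherePoint x y + hemispherePoint x' y') 2
  linarith [le_abs_self (Real.sqrt (1 - x ^ 2 - y ^ 2) + Real.sqrt (1 - x' ^ 2 - y' ^ 2))]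

lemma one_div_le_abs_div_sub_div {a b : ℕ} (hab : a ≠ b) {r : ℝ} (hr : 0 < r) :
    1 / r ≤ |a / r - b / r| := by
  have h : (1 : ℝ) ≤ |(a : ℝ) - b| := by
    have hab' : (a : ℤ) ≠ b := Nat.cast_injective.ne hab
    exact_mod_cast Int.one_le_abs (sub_ne_zero.mpr hab')
  rw [← sub_div, abs_div, abs_of_pos hr]
  gcongr

lemma natCast_div_two_mul_sq_le {a m : ℕ} (h : a < m) : ((a : ℝ) / (2 * m)) ^ 2 ≤ 1 / 4 := by
  have hm : (0 : ℝ) < m := by exact_mod_cast a.zero_le.trans_lt h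
  have ham : (a : ℝ) ≤ m := by exact_mod_cast h.le
  have hle : (a : ℝ) / (2 * m) ≤ 1 / 2 := by
    rw [div_le_div_iff₀ (by positivity) two_pos]
    linarith
  calc ((a : ℝ) / (2 * m)) ^ 2 ≤ (1 / 2) ^ 2 := by gcongr
    _ = 1 / 4 := by norm_num

/-- There is `c > 0` such that for every `n ≥ 1` there are points
`p₁, …, pₙ` on the unit sphere in `ℝ³` with `‖pᵢ - pⱼ‖ ≥ c/√n` and `‖pᵢ + pⱼ‖ ≥ c/√n`
for all `i ≠ j`. -/
theorem exists_antipodally_separated_points :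
    ∃ c : ℝ, 0 < c ∧ ∀ n : ℕ, 1 ≤ n →
      ∃ p : Fin n → sphere (0 : EuclideanSpace ℝ (Fin 3)) 1,
        ∀ i j, i ≠ j →
          c / Real.sqrt n ≤ ‖(p i : EuclideanSpace ℝ (Fin 3)) - (p j : EuclideanSpace ℝ (Fin 3))‖ ∧
          c / Real.sqrt n ≤ ‖(p i : EuclideanSpace ℝ (Fin 3)) + (p j : EuclideanSpace ℝ (Fin 3))‖ := by
  refine ⟨1 / 4, by norm_num, fun n hn => ?_⟩
  have hs : 1 ≤ Real.sqrt n := Real.one_le_sqrt.mpr (by exact_mod_cast hn)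
  obtain ⟨m, hm, hnm, hmn⟩ : ∃ m : ℕ, 0 < m ∧ n < m * m ∧ (m : ℝ) ≤ 2 * Real.sqrt n := by
    refine ⟨Nat.sqrt n + 1, Nat.succ_pos _, Nat.lt_succ_sqrt n, ?_⟩
    have hsqrt : (Nat.sqrt n : ℝ) ≤ Real.sqrt n := Real.nat_sqrt_le_real_sqrt
    push_cast
    linarith
  have hm' : (0 : ℝ) < m := by exact_mod_cast hm
  have hc : 1 / 4 / Real.sqrt n ≤ 1 / (2 * m) := by
    rw [div_div]
    exact one_div_le_one_div_of_le (by positivity) (by linarith)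
  have hsq (i : Fin n) : (((i / m : ℕ) : ℝ) / (2 * m)) ^ 2 + (((i % m : ℕ) : ℝ) / (2 * m)) ^ 2
      ≤ 1 / 2 := by
    linarith [natCast_div_two_mul_sq_le (Nat.div_lt_of_lt_mul (i.2.trans hnm)),
      natCast_div_two_mul_sq_le (Nat.mod_lt i hm)]
  refine ⟨fun i => ⟨hemispherePoint ((i / m : ℕ) / (2 * m)) ((i % m : ℕ) / (2 * m)), ?_⟩,
    fun i j hij => ⟨?_, ?_⟩⟩
  · rw [mem_sphere_zero_iff_norm]
    exact norm_hemispherePoint ((hsq i).trans (by norm_num))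
  · have hsub := abs_sub_le_norm_hemispherePoint_sub ((i / m : ℕ) / (2 * m : ℝ))
      ((i % m : ℕ) / (2 * m)) ((j / m : ℕ) / (2 * m)) ((j % m : ℕ) / (2 * m))
    by_cases hd : (i / m : ℕ) = j / m
    · have hr : (i % m : ℕ) ≠ j % m := fun hr => hij <| Fin.ext <| by
        rw [← Nat.div_add_mod i m, ← Nat.div_add_mod j m, hd, hr]
      exact (hc.trans (one_div_le_abs_div_sub_div hr (by positivity))).trans hsub.2
    · exact (hc.trans (one_div_le_abs_div_sub_div hd (by positivity))).trans hsub.1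
  · refine le_trans ?_ (one_le_norm_hemispherePoint_add (hsq i) (hsq j))
    rw [div_le_one (by positivity)]
    linarith
end

section
/- Let n ≥ 2 and let p₁, …, pₙ be points on the unit sphere S² ⊂ ℝ³ with ‖p_i − p_j‖ ≥ 1/√n for all i ≠ j. Then there are constants (depending only on s where indicated) such that: (i) for every s with 0 < s < 2, Σ_{i≠j} ‖p_i − p_j‖^{−s} ≤ C_s · n²; (ii) Σ_{i≠j} ‖p_i − p_j‖^{−2} ≤ C · n² · log n; (iii) for every s > 2, Σ_{i≠j} ‖p_i − p_j‖^{−s} ≤ C_s · n^{1+s/2}. -/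
open Metric Finset

open MeasureTheory in
/-- Volume packing bound: a `δ`-separated finite family inside a ball of radius `R`. -/
theorem card_mul_pow_finrank_le_of_separated {E ι : Type*} [NormedAddCommGroup E]
    [NormedSpace ℝ E] [FiniteDimensional ℝ E] (T : Finset ι) (f : ι → E) (c : E) {δ R : ℝ}
    (hδ : 0 < δ) (hR : 0 ≤ R) (hsep : ∀ i ∈ T, ∀ j ∈ T, i ≠ j → δ ≤ ‖f i - f j‖)
    (hball : ∀ i ∈ T, ‖f i - c‖ ≤ R) :
    (#T : ℝ) * (δ / 2) ^ Module.finrank ℝ E ≤ (R + δ / 2) ^ Module.finrank ℝ E := by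
  borelize E
  let μ : Measure E := Measure.addHaar
  have hδ2 : 0 < δ / 2 := by positivity
  have hdisj : (T : Set ι).Pairwise (Function.onFun Disjoint fun i => ball (f i) (δ / 2)) := by
    intro i hi j hj hij
    apply ball_disjoint_ball
    rw [dist_eq_norm]
    linarith [hsep i hi j hj hij]
  have hsub : (⋃ i ∈ T, ball (f i) (δ / 2)) ⊆ ball c (R + δ / 2) := by
    refine Set.iUnion₂_subset fun i hi => ball_subset_ball' ?_
    rw [dist_eq_norm]
    linarith [hball i hi]
  have hvol : (#T : ENNReal) * ENNReal.ofReal ((δ / 2) ^ Module.finrank ℝ E) * μ (ball 0 1) ≤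
      ENNReal.ofReal ((R + δ / 2) ^ Module.finrank ℝ E) * μ (ball 0 1) := by
    calc
      _ = μ (⋃ i ∈ T, ball (f i) (δ / 2)) := by
        rw [measure_biUnion_finset hdisj fun _ _ => measurableSet_ball]
        simp only [μ.addHaar_ball_of_pos _ hδ2, sum_const, nsmul_eq_mul, mul_assoc]
      _ ≤ μ (ball c (R + δ / 2)) := measure_mono hsub
      _ = _ := by rw [μ.addHaar_ball_of_pos _ (by positivity)]
  have h := (ENNReal.mul_le_mul_iff_left (measure_ball_pos _ _ zero_lt_one).ne'
    measure_ball_lt_top.ne).1 hvol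
  rw [← ENNReal.ofReal_natCast, ← ENNReal.ofReal_mul (by positivity)] at h
  exact (ENNReal.ofReal_le_ofReal_iff (by positivity)).1 h

/-- A `δ`-separated family of unit vectors in a cap of radius `r` has `O((r / δ) ^ 2)` elements.
The proof applies volume packing to the family of all radial dilates by `1 + k δ`, `k δ ≤ r`. -/
theorem card_le_of_separated_of_norm_eq_one {ι : Type*} (T : Finset ι)
    (f : ι → EuclideanSpace ℝ (Fin 3)) (c : EuclideanSpace ℝ (Fin 3)) {δ r : ℝ}
    (hδ : 0 < δ) (hr : δ ≤ r) (hf : ∀ i ∈ T, ‖f i‖ = 1)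
    (hsep : ∀ i ∈ T, ∀ j ∈ T, i ≠ j → δ ≤ ‖f i - f j‖) (hball : ∀ i ∈ T, ‖f i - c‖ ≤ r) :
    (#T : ℝ) ≤ 125 * (r / δ) ^ 2 := by
  have hr0 : 0 < r := hδ.trans_le hr
  set K := ⌊r / δ⌋₊
  have hK : (K : ℝ) ≤ r / δ := Nat.floor_le (by positivity)
  have hK' : r / δ < K + 1 := Nat.lt_floor_add_one _
  have hpack := card_mul_pow_finrank_le_of_separated (T ×ˢ range (K + 1))
    (fun x => (1 + (x.2 : ℝ) * δ) • f x.1) c hδ (R := 2 * r) (by positivity)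
    (by
      rintro ⟨i, k⟩ hi ⟨j, l⟩ hj hne
      simp only [mem_product] at hi hj
      dsimp only
      by_cases hkl : k = l
      · subst hkl
        have hij : i ≠ j := fun h => hne (by rw [h])
        rw [← smul_sub, norm_smul, Real.norm_of_nonneg (by positivity)]
        have : 0 ≤ (k : ℝ) * δ := by positivity
        nlinarith [hsep i hi.1 j hj.1 hij, norm_nonneg (f i - f j)]
      · have h1 : (1 : ℝ) ≤ |(k : ℝ) - l| := by
          exact_mod_cast Int.one_le_abs (sub_ne_zero.2 (by exact_mod_cast hkl : (k : ℤ) ≠ l))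
        refine le_trans ?_ (abs_norm_sub_norm_le _ _)
        rw [norm_smul, norm_smul, hf i hi.1, hf j hj.1, Real.norm_of_nonneg (by positivity),
          Real.norm_of_nonneg (by positivity),
          show (1 + (k : ℝ) * δ) * 1 - (1 + l * δ) * 1 = (k - l) * δ by ring, abs_mul,
          abs_of_pos hδ]
        exact le_mul_of_one_le_left hδ.le h1)
    (by
      rintro ⟨i, k⟩ hi
      simp only [mem_product, mem_range, Nat.lt_succ_iff] at hi
      dsimp only
      have hk : (k : ℝ) * δ ≤ r := by
        rw [← le_div_iff₀ hδ]
        exact le_trans (by exact_mod_cast hi.2) hK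
      calc
        _ = ‖(f i - c) + ((k : ℝ) * δ) • f i‖ := by congr 1; module
        _ ≤ ‖f i - c‖ + ‖((k : ℝ) * δ) • f i‖ := norm_add_le _ _
        _ ≤ 2 * r := by
          rw [norm_smul, hf i hi.1, Real.norm_of_nonneg (by positivity)]
          linarith [hball i hi.1])
  rw [finrank_euclideanSpace_fin, card_product, card_range] at hpack
  push_cast at hpack
  have h2 : (2 * r + δ / 2) ^ 3 ≤ (5 * r / 2) ^ 3 := by gcongr; linarith
  have h3 : (#T : ℝ) * (r / δ) * (δ / 2) ^ 3 ≤ #T * (K + 1) * (δ / 2) ^ 3 := by gcongr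
  have h4 := h3.trans (hpack.trans h2)
  have h5 : (#T : ℝ) * (r * δ ^ 2 / 8) ≤ 125 * (r / δ) ^ 2 * (r * δ ^ 2 / 8) := by
    calc
      _ = (#T : ℝ) * (r / δ) * (δ / 2) ^ 3 := by field_simp; norm_num
      _ ≤ (5 * r / 2) ^ 3 := h4
      _ = _ := by field_simp; norm_num
  exact le_of_mul_le_mul_right h5 (by positivity)

/-- Dyadic bound for the Riesz potential at a point of a `1 / √n`-separated family on the
sphere. -/
theorem sum_norm_rpow_neg_le_dyadic {n : ℕ} (hn : 2 ≤ n)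
    (p : Fin n → sphere (0 : EuclideanSpace ℝ (Fin 3)) 1)
    (hp : ∀ i j, i ≠ j → 1 / Real.sqrt n ≤
      ‖(p i : EuclideanSpace ℝ (Fin 3)) - (p j : EuclideanSpace ℝ (Fin 3))‖)
    {s : ℝ} (hs : 0 < s) (i : Fin n) :
    ∑ j ∈ univ.erase i,
        ‖(p i : EuclideanSpace ℝ (Fin 3)) - (p j : EuclideanSpace ℝ (Fin 3))‖ ^ (-s) ≤
      500 * (n : ℝ) ^ (s / 2) *
        ∑ k ∈ range (Nat.log 2 ⌊2 * √(n : ℝ)⌋₊ + 1), ((2 : ℝ) ^ (2 - s)) ^ k := by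
  have hn0 : (0 : ℝ) < n := by positivity
  have hsq : 0 < √(n : ℝ) := Real.sqrt_pos.2 hn0
  have hnorm : ∀ j, ‖(p j : EuclideanSpace ℝ (Fin 3))‖ = 1 := fun j => by simp
  set d : Fin n → ℝ := fun j =>
    ‖(p i : EuclideanSpace ℝ (Fin 3)) - (p j : EuclideanSpace ℝ (Fin 3))‖
  have hd2 : ∀ j, d j ≤ 2 := fun j => by
    have := norm_sub_le (p i : EuclideanSpace ℝ (Fin 3)) (p j)
    rw [hnorm, hnorm] at this
    linarith
  have hd1 : ∀ j ∈ univ.erase i, 1 ≤ d j * √(n : ℝ) := fun j hj =>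
    (div_le_iff₀ hsq).1 (hp i j (ne_of_mem_erase hj).symm)
  set lev : Fin n → ℕ := fun j => Nat.log 2 ⌊d j * √(n : ℝ)⌋₊
  have hmaps : ∀ j ∈ univ.erase i, lev j ∈ range (Nat.log 2 ⌊2 * √(n : ℝ)⌋₊ + 1) := by
    intro j _
    rw [mem_range, Nat.lt_succ_iff]
    exact Nat.log_mono_right (Nat.floor_mono (by gcongr; exact hd2 j))
  have hlow : ∀ j ∈ univ.erase i, (2 : ℝ) ^ lev j ≤ d j * √(n : ℝ) := fun j hj => by
    have h := Nat.pow_log_le_self 2 (Nat.floor_pos.2 (hd1 j hj)).ne'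
    exact le_trans (by exact_mod_cast h) (Nat.floor_le (zero_le_one.trans (hd1 j hj)))
  have hup : ∀ j, d j * √(n : ℝ) ≤ 2 ^ (lev j + 1) := fun j => by
    have h : ⌊d j * √(n : ℝ)⌋₊ + 1 ≤ 2 ^ (lev j + 1) := Nat.lt_pow_succ_log_self one_lt_two _
    exact (Nat.lt_floor_add_one _).le.trans (by exact_mod_cast h)
  rw [← sum_fiberwise_of_maps_to hmaps, mul_sum]
  refine sum_le_sum fun k _ => ?_
  have hcard : (#{j ∈ univ.erase i | lev j = k} : ℝ) ≤ 500 * 4 ^ k := by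
    have h := card_le_of_separated_of_norm_eq_one {j ∈ univ.erase i | lev j = k}
      (fun j => (p j : EuclideanSpace ℝ (Fin 3))) (p i)
      (δ := 1 / √(n : ℝ)) (r := 2 ^ (k + 1) / √(n : ℝ)) (by positivity)
      (by gcongr; exact one_le_pow₀ one_le_two) (fun j _ => hnorm j)
      (fun j _ l _ hjl => hp j l hjl)
      (fun j hj => by
        rw [norm_sub_rev, le_div_iff₀ hsq, ← (mem_filter.1 hj).2]
        exact hup j)
    refine h.trans_eq ?_
    rw [div_div_div_cancel_right₀ hsq.ne', div_one, ← pow_mul, show (4 : ℝ) = 2 ^ 2 by norm_num,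
      ← pow_mul]
    ring
  have hterm : ∀ j ∈ ({j ∈ univ.erase i | lev j = k} : Finset (Fin n)),
      d j ^ (-s) ≤ (n : ℝ) ^ (s / 2) * ((2 : ℝ) ^ (-s)) ^ k := by
    intro j hj
    rw [mem_filter] at hj
    have h : (2 : ℝ) ^ k / √(n : ℝ) ≤ d j := by
      rw [div_le_iff₀ hsq, ← hj.2]
      exact hlow j hj.1
    refine (Real.rpow_le_rpow_of_nonpos (by positivity) h (by linarith)).trans_eq ?_
    rw [Real.div_rpow (by positivity) hsq.le, ← Real.rpow_natCast, ← Real.rpow_mul (by norm_num),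
      ← Real.rpow_natCast, ← Real.rpow_mul (by norm_num), Real.sqrt_eq_rpow,
      ← Real.rpow_mul hn0.le, div_eq_mul_inv, ← Real.rpow_neg hn0.le, mul_comm]
    congr 2 <;> ring
  calc
    _ ≤ #{j ∈ univ.erase i | lev j = k} • ((n : ℝ) ^ (s / 2) * ((2 : ℝ) ^ (-s)) ^ k) :=
      sum_le_card_nsmul _ _ _ hterm
    _ ≤ (500 * 4 ^ k) * ((n : ℝ) ^ (s / 2) * ((2 : ℝ) ^ (-s)) ^ k) := by
      rw [nsmul_eq_mul]; gcongr
    _ = _ := by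
      rw [sub_eq_add_neg, Real.rpow_add two_pos, mul_pow, Real.rpow_two]
      norm_num
      ring

/-- Dyadic bound for the Riesz energy of a `1 / √n`-separated family on the sphere. -/
theorem sum_offDiag_norm_rpow_neg_le_dyadic {n : ℕ} (hn : 2 ≤ n)
    (p : Fin n → sphere (0 : EuclideanSpace ℝ (Fin 3)) 1)
    (hp : ∀ i j, i ≠ j → 1 / Real.sqrt n ≤
      ‖(p i : EuclideanSpace ℝ (Fin 3)) - (p j : EuclideanSpace ℝ (Fin 3))‖)
    {s : ℝ} (hs : 0 < s) :
    ∑ ij ∈ (Finset.univ : Finset (Fin n)).offDiag,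
        ‖(p ij.1 : EuclideanSpace ℝ (Fin 3)) - (p ij.2 : EuclideanSpace ℝ (Fin 3))‖ ^ (-s) ≤
      500 * (n : ℝ) ^ (1 + s / 2) *
        ∑ k ∈ range (Nat.log 2 ⌊2 * √(n : ℝ)⌋₊ + 1), ((2 : ℝ) ^ (2 - s)) ^ k := by
  have hn0 : (0 : ℝ) < n := by positivity
  rw [sum_finset_product' _ univ (fun i => univ.erase i)
    (f := fun i j => ‖(p i : EuclideanSpace ℝ (Fin 3)) - (p j : EuclideanSpace ℝ (Fin 3))‖ ^ (-s))
    (by simp [eq_comm])]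
  refine (sum_le_card_nsmul _ _ _
    fun i _ => sum_norm_rpow_neg_le_dyadic hn p hp hs i).trans_eq ?_
  rw [card_univ, Fintype.card_fin, nsmul_eq_mul, Real.rpow_add hn0, Real.rpow_one]
  ring

/-- The largest dyadic level is at most `log₂ (2 √n)`. -/
theorem two_pow_log_floor_two_mul_sqrt_le {n : ℕ} (hn : 2 ≤ n) :
    (2 : ℝ) ^ Nat.log 2 ⌊2 * √(n : ℝ)⌋₊ ≤ 2 * √(n : ℝ) := by
  have h1 : 1 ≤ 2 * √(n : ℝ) := by
    have : 1 ≤ √(n : ℝ) := Real.one_le_sqrt.2 (by exact_mod_cast (by omega : 1 ≤ n))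
    linarith
  have h := Nat.pow_log_le_self 2 (Nat.floor_pos.2 h1).ne'
  exact le_trans (by exact_mod_cast h) (Nat.floor_le (by positivity))

/-- For points `p₁, …, pₙ` on the unit sphere in `ℝ³` with pairwise
distances at least `1/√n` (`n ≥ 2`):
(i) for `0 < s < 2`, `∑_{i≠j} ‖pᵢ - pⱼ‖⁻ˢ ≤ C_s n²`;
(ii) `∑_{i≠j} ‖pᵢ - pⱼ‖⁻² ≤ C n² log n`;
(iii) for `s > 2`, `∑_{i≠j} ‖pᵢ - pⱼ‖⁻ˢ ≤ C_s n^{1+s/2}`. -/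
theorem riesz_energy_upper_bounds_of_separated_points :
    (∀ s : ℝ, 0 < s → s < 2 →
      ∃ C : ℝ, 0 < C ∧ ∀ n : ℕ, 2 ≤ n →
        ∀ p : Fin n → sphere (0 : EuclideanSpace ℝ (Fin 3)) 1,
          (∀ i j, i ≠ j → 1 / Real.sqrt n ≤
            ‖(p i : EuclideanSpace ℝ (Fin 3)) - (p j : EuclideanSpace ℝ (Fin 3))‖) →
          ∑ ij ∈ (Finset.univ : Finset (Fin n)).offDiag,
              ‖(p ij.1 : EuclideanSpace ℝ (Fin 3)) - (p ij.2 : EuclideanSpace ℝ (Fin 3))‖ ^ (-s) ≤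
            C * (n : ℝ) ^ 2) ∧
    (∃ C : ℝ, 0 < C ∧ ∀ n : ℕ, 2 ≤ n →
      ∀ p : Fin n → sphere (0 : EuclideanSpace ℝ (Fin 3)) 1,
        (∀ i j, i ≠ j → 1 / Real.sqrt n ≤
          ‖(p i : EuclideanSpace ℝ (Fin 3)) - (p j : EuclideanSpace ℝ (Fin 3))‖) →
        ∑ ij ∈ (Finset.univ : Finset (Fin n)).offDiag,
            ‖(p ij.1 : EuclideanSpace ℝ (Fin 3)) - (p ij.2 : EuclideanSpace ℝ (Fin 3))‖ ^ (-(2:ℝ)) ≤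
          C * (n : ℝ) ^ 2 * Real.log n) ∧
    (∀ s : ℝ, 2 < s →
      ∃ C : ℝ, 0 < C ∧ ∀ n : ℕ, 2 ≤ n →
        ∀ p : Fin n → sphere (0 : EuclideanSpace ℝ (Fin 3)) 1,
          (∀ i j, i ≠ j → 1 / Real.sqrt n ≤
            ‖(p i : EuclideanSpace ℝ (Fin 3)) - (p j : EuclideanSpace ℝ (Fin 3))‖) →
          ∑ ij ∈ (Finset.univ : Finset (Fin n)).offDiag,
              ‖(p ij.1 : EuclideanSpace ℝ (Fin 3)) - (p ij.2 : EuclideanSpace ℝ (Fin 3))‖ ^ (-s) ≤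
            C * (n : ℝ) ^ ((1 : ℝ) + s / 2)) := by
  refine ⟨fun s hs hs2 => ?_, ⟨2500, by norm_num, fun n hn p hp => ?_⟩, fun s hs => ?_⟩
  · set q : ℝ := 2 ^ (2 - s) with hq
    have hq1 : 1 < q := Real.one_lt_rpow one_lt_two (by linarith)
    have hq1' : 0 < q - 1 := by linarith
    refine ⟨500 * (q ^ 2 / (q - 1)), by positivity, fun n hn p hp => ?_⟩
    have hn0 : (0 : ℝ) < n := by positivity
    refine (sum_offDiag_norm_rpow_neg_le_dyadic hn p hp hs).trans ?_
    set K := Nat.log 2 ⌊2 * √(n : ℝ)⌋₊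
    have hqK : q ^ K ≤ q * (n : ℝ) ^ (1 - s / 2) := by
      calc
        q ^ K = ((2 : ℝ) ^ K) ^ (2 - s) := by
          rw [hq, ← Real.rpow_mul_natCast two_pos.le, mul_comm, Real.rpow_natCast_mul two_pos.le]
        _ ≤ (2 * √(n : ℝ)) ^ (2 - s) :=
          Real.rpow_le_rpow (by positivity) (two_pow_log_floor_two_mul_sqrt_le hn) (by linarith)
        _ = _ := by
          rw [Real.mul_rpow two_pos.le (Real.sqrt_nonneg _), Real.sqrt_eq_rpow,
            ← Real.rpow_mul hn0.le]
          congr 2; ring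
    have hgeom : ∑ k ∈ range (K + 1), q ^ k ≤ q ^ 2 / (q - 1) * (n : ℝ) ^ (1 - s / 2) := by
      rw [geom_sum_eq hq1.ne', div_mul_eq_mul_div]
      gcongr
      calc
        q ^ (K + 1) - 1 ≤ q ^ K * q := by rw [pow_succ]; linarith
        _ ≤ q * (n : ℝ) ^ (1 - s / 2) * q := by gcongr
        _ = _ := by ring
    calc
      _ ≤ 500 * (n : ℝ) ^ (1 + s / 2) * (q ^ 2 / (q - 1) * (n : ℝ) ^ (1 - s / 2)) := by gcongr
      _ = 500 * (q ^ 2 / (q - 1)) * ((n : ℝ) ^ (1 + s / 2) * (n : ℝ) ^ (1 - s / 2)) := by ring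
      _ = _ := by
        rw [← Real.rpow_add hn0, show 1 + s / 2 + (1 - s / 2) = 2 by ring, Real.rpow_two]
  · have hn0 : (0 : ℝ) < n := by positivity
    refine (sum_offDiag_norm_rpow_neg_le_dyadic hn p hp two_pos).trans ?_
    set K := Nat.log 2 ⌊2 * √(n : ℝ)⌋₊
    have hlog2 : Real.log 2 ≤ Real.log n := Real.log_le_log two_pos (by exact_mod_cast hn)
    have hK : K * Real.log 2 ≤ Real.log 2 + Real.log n / 2 := by
      have h := Real.log_le_log (by positivity) (two_pow_log_floor_two_mul_sqrt_le hn)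
      rwa [Real.log_pow, Real.log_mul two_ne_zero (Real.sqrt_pos.2 hn0).ne',
        Real.log_sqrt hn0.le] at h
    have hK' : (K : ℝ) + 1 ≤ 5 * Real.log n := by
      nlinarith [Real.log_two_gt_d9, (Nat.cast_nonneg K : (0 : ℝ) ≤ K)]
    have hsum : ∑ k ∈ range (K + 1), ((2 : ℝ) ^ ((2 : ℝ) - 2)) ^ k = K + 1 := by simp
    rw [hsum, show (1 : ℝ) + 2 / 2 = 2 by norm_num, Real.rpow_two]
    calc
      _ ≤ 500 * (n : ℝ) ^ 2 * (5 * Real.log n) := by gcongr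
      _ = _ := by ring
  · set q : ℝ := 2 ^ (2 - s)
    have hq0 : 0 < q := by positivity
    have hq1 : q < 1 := Real.rpow_lt_one_of_one_lt_of_neg one_lt_two (by linarith)
    have hq1' : 0 < 1 - q := by linarith
    refine ⟨500 * (1 - q)⁻¹, by positivity, fun n hn p hp => ?_⟩
    refine (sum_offDiag_norm_rpow_neg_le_dyadic hn p hp (by linarith)).trans ?_
    rw [mul_right_comm]
    gcongr
    rw [← tsum_geometric_of_lt_one hq0.le hq1]
    exact (summable_geometric_of_lt_one hq0.le hq1).sum_le_tsum _ fun k _ => by positivity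
end

section
/- There exists an absolute constant C > 0 such that for every n ≥ 2 and all points p₁, …, pₙ on the unit sphere S² ⊂ ℝ³ that are pairwise distinct, one has Σ_{i=1}^{n} ( min_{j ≠ i} ‖p_i − p_j‖ )² ≤ C. -/
open Metric Finset

open MeasureTheory in
/-- Pairwise disjoint balls contained in a large ball: a volume comparison. -/
theorem sum_radius_pow_finrank_le {E ι : Type*} [NormedAddCommGroup E] [NormedSpace ℝ E]
    [FiniteDimensional ℝ E] [Nontrivial E] (s : Finset ι) (q : ι → E) (r : ι → ℝ)
    {R : ℝ} (hR : 0 < R)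
    (hr : ∀ i ∈ s, 0 ≤ r i) (hqR : ∀ i ∈ s, ‖q i‖ + r i ≤ R)
    (hq : ∀ i ∈ s, ∀ j ∈ s, i ≠ j → r i + r j ≤ dist (q i) (q j)) :
    ∑ i ∈ s, r i ^ Module.finrank ℝ E ≤ R ^ Module.finrank ℝ E := by
  borelize E
  let μ : Measure E := Measure.addHaar
  have hsub : (⋃ i ∈ s, ball (q i) (r i)) ⊆ ball (0 : E) R :=
    Set.iUnion₂_subset fun i hi ↦ ball_subset_ball' (by
      rw [dist_zero_right]; linarith [hqR i hi])
  have hdisj : (s : Set ι).PairwiseDisjoint fun i ↦ ball (q i) (r i) :=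
    fun i hi j hj hij ↦ ball_disjoint_ball (hq i hi j hj hij)
  have h := measure_mono (μ := μ) hsub
  rw [measure_biUnion_finset hdisj fun i _ ↦ measurableSet_ball,
    Measure.addHaar_ball μ _ hR.le,
    Finset.sum_congr rfl fun i hi ↦ Measure.addHaar_ball μ (q i) (hr i hi), ← Finset.sum_mul,
    ENNReal.mul_le_mul_iff_left (measure_ball_pos μ 0 one_pos).ne' measure_ball_lt_top.ne,
    ← ENNReal.ofReal_sum_of_nonneg fun i hi ↦ pow_nonneg (hr i hi) _] at h
  exact (ENNReal.ofReal_le_ofReal_iff (by positivity)).1 h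

/-- The projection of `ℝ³` to `ℝ²` forgetting the `k`-th coordinate. -/
def forgetCoord (k : Fin 3) (x : EuclideanSpace ℝ (Fin 3)) : EuclideanSpace ℝ (Fin 2) :=
  WithLp.toLp 2 fun i ↦ x (k.succAbove i)

theorem forgetCoord_sub (k : Fin 3) (x y : EuclideanSpace ℝ (Fin 3)) :
    forgetCoord k (x - y) = forgetCoord k x - forgetCoord k y := rfl

theorem norm_sq_eq_add_norm_forgetCoord_sq (k : Fin 3) (x : EuclideanSpace ℝ (Fin 3)) :
    ‖x‖ ^ 2 = x k ^ 2 + ‖forgetCoord k x‖ ^ 2 := by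
  rw [EuclideanSpace.real_norm_sq_eq, EuclideanSpace.real_norm_sq_eq, Fin.sum_univ_succAbove _ k]
  rfl

theorem norm_forgetCoord_le (k : Fin 3) (x : EuclideanSpace ℝ (Fin 3)) :
    ‖forgetCoord k x‖ ≤ ‖x‖ := by
  rw [← sq_le_sq₀ (norm_nonneg _) (norm_nonneg _), norm_sq_eq_add_norm_forgetCoord_sq k x]
  linarith [sq_nonneg (x k)]

/-- On a spherical cap, forgetting a coordinate bounded away from zero is bi-Lipschitz. -/
theorem norm_sub_le_three_mul_norm_forgetCoord_sub {k : Fin 3} {x y : EuclideanSpace ℝ (Fin 3)}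
    (hx : ‖x‖ = 1) (hy : ‖y‖ = 1) (h : 1 ≤ |x k + y k|) :
    ‖x - y‖ ≤ 3 * ‖forgetCoord k x - forgetCoord k y‖ := by
  have hx2 := norm_sq_eq_add_norm_forgetCoord_sq k x
  have hy2 := norm_sq_eq_add_norm_forgetCoord_sq k y
  have hxy := norm_sq_eq_add_norm_forgetCoord_sq k (x - y)
  have hx1 := norm_forgetCoord_le k x
  have hy1 := norm_forgetCoord_le k y
  rw [forgetCoord_sub, PiLp.sub_apply] at hxy
  have htri := abs_norm_sub_norm_le (forgetCoord k x) (forgetCoord k y)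
  set a := ‖forgetCoord k x‖
  set b := ‖forgetCoord k y‖
  set c := ‖forgetCoord k x - forgetCoord k y‖
  have ha : 0 ≤ a := norm_nonneg _
  have hb : 0 ≤ b := norm_nonneg _
  have hc : 0 ≤ c := norm_nonneg _
  have hk : |x k - y k| ≤ 2 * c := by
    calc |x k - y k| ≤ |x k + y k| * |x k - y k| := le_mul_of_one_le_left (abs_nonneg _) h
      _ = |a - b| * (a + b) := by
        rw [← abs_of_nonneg (add_nonneg ha hb), ← abs_mul, ← abs_mul, abs_eq_abs]
        rw [hx] at hx2
        rw [hy] at hy2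
        right
        linear_combination hy2 - hx2
      _ ≤ c * 2 := by gcongr; linarith
      _ = 2 * c := mul_comm _ _
  rw [← sq_le_sq₀ (norm_nonneg _) (by positivity), hxy, ← sq_abs (x k - y k)]
  nlinarith [abs_nonneg (x k - y k)]

theorem exists_half_le_abs_coord {x : EuclideanSpace ℝ (Fin 3)} (hx : ‖x‖ = 1) :
    ∃ k, 1 / 2 ≤ |x k| := by
  by_contra! h
  have hs := EuclideanSpace.real_norm_sq_eq x
  rw [hx, Fin.sum_univ_three] at hs
  have hsq (k : Fin 3) : x k ^ 2 < 1 / 4 := by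
    rw [← sq_abs]
    nlinarith [h k, abs_nonneg (x k)]
  linarith [hsq 0, hsq 1, hsq 2]

/-- Packing on a spherical cap. -/
theorem sum_sq_le_of_forall_add {ι : Type*} (s : Finset ι) (x : ι → EuclideanSpace ℝ (Fin 3))
    (d : ι → ℝ) (k : Fin 3) (hx : ∀ i, ‖x i‖ = 1) (hd0 : ∀ i, 0 ≤ d i) (hd2 : ∀ i, d i ≤ 2)
    (hd : ∀ i j, j ≠ i → d i ≤ ‖x i - x j‖)
    (hs : ∀ i ∈ s, ∀ j ∈ s, 1 ≤ |x i k + x j k|) :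
    ∑ i ∈ s, d i ^ 2 ≤ 144 := by
  have h := sum_radius_pow_finrank_le s (fun i ↦ forgetCoord k (x i)) (fun i ↦ d i / 6)
    (R := 2) two_pos (fun i _ ↦ by linarith [hd0 i])
    (fun i _ ↦ by linarith [norm_forgetCoord_le k (x i), hx i, hd2 i])
    (fun i hi j hj hij ↦ by
      rw [dist_eq_norm]
      have hji := hd j i hij
      rw [norm_sub_rev] at hji
      linarith [hd i j hij.symm,
        norm_sub_le_three_mul_norm_forgetCoord_sub (hx i) (hx j) (hs i hi j hj)])
  simp only [finrank_euclideanSpace_fin, div_pow, ← Finset.sum_div] at h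
  linarith

/-- The sphere is covered by six caps, so the planar packing bound gives a spherical one. -/
theorem sum_sq_le_of_le_norm_sub {ι : Type*} [Fintype ι] (x : ι → EuclideanSpace ℝ (Fin 3))
    (d : ι → ℝ) (hx : ∀ i, ‖x i‖ = 1) (hd0 : ∀ i, 0 ≤ d i) (hd2 : ∀ i, d i ≤ 2)
    (hd : ∀ i j, j ≠ i → d i ≤ ‖x i - x j‖) :
    ∑ i, d i ^ 2 ≤ 864 := by
  classical
  let cap (k : Fin 3) (ε : Bool) : Finset ι :=
    {i | 1 / 2 ≤ if ε then x i k else -x i k}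
  have hcap (k : Fin 3) (ε : Bool) : ∑ i ∈ cap k ε, d i ^ 2 ≤ 144 := by
    refine sum_sq_le_of_forall_add _ x d k hx hd0 hd2 hd fun i hi j hj ↦ ?_
    simp only [cap, mem_filter, mem_univ, true_and] at hi hj
    cases ε <;> simp only [if_true, Bool.false_eq_true, if_false] at hi hj
    · exact le_abs.2 (Or.inr (by linarith))
    · exact le_abs.2 (Or.inl (by linarith))
  have hcover (i : ι) : ∃ c : Fin 3 × Bool, i ∈ cap c.1 c.2 := by
    obtain ⟨k, hk⟩ := exists_half_le_abs_coord (hx i)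
    rcases le_abs.1 hk with h | h
    · exact ⟨(k, true), by simpa [cap] using h⟩
    · exact ⟨(k, false), by simpa [cap] using h⟩
  choose c hc using hcover
  calc ∑ i, d i ^ 2 = ∑ b, ∑ i with c i = b, d i ^ 2 := (sum_fiberwise _ _ _).symm
    _ ≤ ∑ b : Fin 3 × Bool, ∑ i ∈ cap b.1 b.2, d i ^ 2 :=
      sum_le_sum fun b _ ↦ sum_le_sum_of_subset_of_nonneg
        (fun i hi ↦ (mem_filter.1 hi).2 ▸ hc i) fun i _ _ ↦ sq_nonneg _
    _ ≤ ∑ _b : Fin 3 × Bool, (144 : ℝ) := sum_le_sum fun b _ ↦ hcap b.1 b.2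
    _ = 864 := by norm_num

/-- There is an absolute `C > 0` such that for any `n ≥ 2` pairwise
distinct points `p₁, …, pₙ` on the unit sphere in `ℝ³`, the sum of the squared
nearest-neighbor distances `∑ᵢ (min_{j ≠ i} ‖pᵢ - pⱼ‖)²` is at most `C`. -/
theorem sum_sq_nearest_neighbor_dist_bounded :
    ∃ C : ℝ, 0 < C ∧ ∀ n : ℕ, 2 ≤ n →
      ∀ p : Fin n → sphere (0 : EuclideanSpace ℝ (Fin 3)) 1,
        Function.Injective p →
        ∑ i : Fin n,
            (sInf {r : ℝ | ∃ j, j ≠ i ∧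
              r = ‖(p i : EuclideanSpace ℝ (Fin 3)) - (p j : EuclideanSpace ℝ (Fin 3))‖}) ^ 2 ≤
          C := by
  refine ⟨864, by norm_num, fun n hn p _ ↦ ?_⟩
  have hp (i : Fin n) : ‖(p i : EuclideanSpace ℝ (Fin 3))‖ = 1 := norm_eq_of_mem_sphere (p i)
  have hle (i j : Fin n) (hij : j ≠ i) :
      sInf {r : ℝ | ∃ j, j ≠ i ∧
        r = ‖(p i : EuclideanSpace ℝ (Fin 3)) - (p j : EuclideanSpace ℝ (Fin 3))‖} ≤
      ‖(p i : EuclideanSpace ℝ (Fin 3)) - (p j : EuclideanSpace ℝ (Fin 3))‖ :=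
    csInf_le ⟨0, by rintro _ ⟨j, -, rfl⟩; exact norm_nonneg _⟩ ⟨j, hij, rfl⟩
  refine sum_sq_le_of_le_norm_sub (fun i ↦ (p i : EuclideanSpace ℝ (Fin 3))) _ hp
    (fun i ↦ Real.sInf_nonneg (by rintro _ ⟨j, -, rfl⟩; exact norm_nonneg _)) (fun i ↦ ?_) hle
  have : Nontrivial (Fin n) := Fin.nontrivial_iff_two_le.2 hn
  obtain ⟨j, hj⟩ := exists_ne i
  refine (hle i j hj).trans ((norm_sub_le _ _).trans ?_)
  rw [hp, hp]
  norm_num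
end

section
/- For every s > 2 there exists a constant c_s > 0 such that for every n ≥ 2 and all pairwise distinct points p₁, …, pₙ on the unit sphere S² ⊂ ℝ³, one has Σ_{i≠j, 1≤i,j≤n} ‖p_i − p_j‖^{−s} ≥ c_s · n^{1+s/2}. -/
open Metric Finset

/-- If `f` maps `ι` into a finset with at most half as many elements, then at least `#ι` ordered
pairs of distinct elements are identified by `f`. -/
lemma card_le_card_offDiag_filter_eq {ι κ : Type*} [Fintype ι] [DecidableEq ι] [DecidableEq κ]
    (f : ι → κ) (T : Finset κ) (hf : ∀ i, f i ∈ T) (hT : 2 * #T ≤ Fintype.card ι) :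
    Fintype.card ι ≤ #{ij ∈ (univ : Finset ι).offDiag | f ij.1 = f ij.2} := by
  have hfib : Fintype.card ι = ∑ t ∈ T, #{i | f i = t} :=
    card_eq_sum_card_fiberwise fun i _ => hf i
  have hpairs : #{ij ∈ (univ : Finset ι).offDiag | f ij.1 = f ij.2} =
      ∑ t ∈ T, #({i | f i = t} : Finset ι).offDiag := by
    rw [card_eq_sum_card_fiberwise (f := fun ij : ι × ι => f ij.1) (t := T) fun ij _ => hf ij.1]
    refine sum_congr rfl fun t _ => congrArg card ?_
    ext ⟨i, j⟩
    simp only [mem_filter, mem_offDiag, mem_univ, true_and]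
    grind
  have hcell : ∀ t ∈ T, 2 * #{i | f i = t} ≤ #({i | f i = t} : Finset ι).offDiag + 2 := by
    intro t _
    rw [offDiag_card]
    generalize #({i | f i = t} : Finset ι) = c
    rcases c with _ | _ | c
    · simp
    · simp
    · have : (c + 1 + 1) * (c + 1 + 1) - (c + 1 + 1) = (c + 2) * (c + 1) := by
        rw [Nat.sub_eq_iff_eq_add (by nlinarith)]; ring
      rw [this]
      nlinarith
  have hsum := sum_le_sum hcell
  rw [← mul_sum, ← hfib, sum_add_distrib, ← hpairs, sum_const, smul_eq_mul] at hsum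
  lia

lemma abs_sub_le_of_floor_mul_eq {m x y : ℝ} (hm : 0 < m) (h : ⌊m * x⌋ = ⌊m * y⌋) :
    |x - y| ≤ 1 / m := by
  rw [le_div_iff₀ hm]
  calc |x - y| * m = |m * x - m * y| := by rw [← mul_sub, abs_mul, abs_of_pos hm, mul_comm]
    _ ≤ 1 := (Int.abs_sub_lt_one_of_floor_eq_floor h).le

lemma floor_mul_mem_Icc {m : ℕ} {x : ℝ} (hx : x ^ 2 ≤ 1) :
    ⌊(m : ℝ) * x⌋ ∈ Icc (-(m : ℤ)) m := by
  obtain ⟨h₁, h₂⟩ := abs_le.1 ((sq_le_one_iff_abs_le_one x).1 hx)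
  have hm : (0 : ℝ) ≤ m := m.cast_nonneg
  rw [mem_Icc, Int.le_floor]
  refine ⟨by push_cast; nlinarith, ?_⟩
  have : ((⌊(m : ℝ) * x⌋ : ℤ) : ℝ) ≤ ((m : ℤ) : ℝ) :=
    (Int.floor_le _).trans (by push_cast; nlinarith)
  exact_mod_cast this

/-- On a cap of the unit sphere where `|z| ≥ 1 / 2`, the distance is controlled by the differences
of the other two coordinates. -/
lemma sq_add_sq_add_sq_le_of_abs_sub_le {x y z x' y' z' ε : ℝ}
    (h : z ^ 2 + x ^ 2 + y ^ 2 = 1) (h' : z' ^ 2 + x' ^ 2 + y' ^ 2 = 1)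
    (hz : 1 / 4 ≤ z ^ 2) (hz' : 1 / 4 ≤ z' ^ 2) (hsign : 0 ≤ z ↔ 0 ≤ z')
    (hx : |x - x'| ≤ ε) (hy : |y - y'| ≤ ε) :
    (z - z') ^ 2 + (x - x') ^ 2 + (y - y') ^ 2 ≤ 18 * ε ^ 2 := by
  have hε : 0 ≤ ε := (abs_nonneg _).trans hx
  have hxsq : (x - x') ^ 2 ≤ ε ^ 2 := sq_le_sq' (abs_le.1 hx).1 (abs_le.1 hx).2
  have hysq : (y - y') ^ 2 ≤ ε ^ 2 := sq_le_sq' (abs_le.1 hy).1 (abs_le.1 hy).2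
  have hprod : 1 / 4 ≤ z * z' := by
    have hnonneg : 0 ≤ z * z' := by
      by_cases h0 : 0 ≤ z
      · exact mul_nonneg h0 (hsign.1 h0)
      · exact mul_nonneg_of_nonpos_of_nonpos (not_le.1 h0).le
          (not_le.1 fun h1 => h0 (hsign.2 h1)).le
    refine le_of_sq_le_sq ?_ hnonneg
    rw [mul_pow]
    nlinarith
  have hplus : 1 ≤ (z + z') ^ 2 := by nlinarith
  have hdiff : (z - z') * (z + z') = -((x - x') * (x + x') + (y - y') * (y + y')) := by
    linear_combination h - h'
  have hxx : (x + x') ^ 2 ≤ 4 := by nlinarith [sq_nonneg (x - x'), sq_nonneg y, sq_nonneg y']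
  have hyy : (y + y') ^ 2 ≤ 4 := by nlinarith [sq_nonneg (y - y'), sq_nonneg x, sq_nonneg x']
  have hbound : ((x - x') * (x + x') + (y - y') * (y + y')) ^ 2 ≤ 16 * ε ^ 2 := by
    have h1 : ((x - x') * (x + x')) ^ 2 ≤ ε ^ 2 * 4 := by
      rw [mul_pow]; exact mul_le_mul hxsq hxx (sq_nonneg _) (sq_nonneg _)
    have h2 : ((y - y') * (y + y')) ^ 2 ≤ ε ^ 2 * 4 := by
      rw [mul_pow]; exact mul_le_mul hysq hyy (sq_nonneg _) (sq_nonneg _)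
    nlinarith [sq_nonneg ((x - x') * (x + x') - (y - y') * (y + y'))]
  have hzsq : (z - z') ^ 2 ≤ 16 * ε ^ 2 := by
    calc (z - z') ^ 2 ≤ (z - z') ^ 2 * (z + z') ^ 2 := le_mul_of_one_le_right (sq_nonneg _) hplus
      _ = ((x - x') * (x + x') + (y - y') * (y + y')) ^ 2 := by rw [← mul_pow, hdiff, neg_sq]
      _ ≤ 16 * ε ^ 2 := hbound
  linarith

lemma norm_sq_eq_cyclic (x : EuclideanSpace ℝ (Fin 3)) (k : Fin 3) :
    ‖x‖ ^ 2 = x k ^ 2 + x (k + 1) ^ 2 + x (k + 2) ^ 2 := by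
  rw [EuclideanSpace.real_norm_sq_eq, Fin.sum_univ_three]
  fin_cases k <;> simp <;> ring

/-- The unit sphere is a union of at most `54 m²` cells of diameter at most `√18 / m`. -/
lemma exists_sphere_cells (m : ℕ) (hm : 0 < m) :
    ∃ (f : sphere (0 : EuclideanSpace ℝ (Fin 3)) 1 → Fin 3 × Bool × ℤ × ℤ)
      (T : Finset (Fin 3 × Bool × ℤ × ℤ)), (∀ x, f x ∈ T) ∧ #T ≤ 54 * m ^ 2 ∧
      ∀ x y, f x = f y → ‖(x : EuclideanSpace ℝ (Fin 3)) - y‖ ^ 2 ≤ 18 / m ^ 2 := by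
  have hsq (x : sphere (0 : EuclideanSpace ℝ (Fin 3)) 1) (k : Fin 3) :
      x.1 k ^ 2 + x.1 (k + 1) ^ 2 + x.1 (k + 2) ^ 2 = 1 := by
    rw [← norm_sq_eq_cyclic, norm_eq_of_mem_sphere x, one_pow]
  have hface (x : sphere (0 : EuclideanSpace ℝ (Fin 3)) 1) : ∃ k, 1 / 4 ≤ x.1 k ^ 2 := by
    by_contra! hlt
    linarith [hsq x 0, hlt 0, hlt (0 + 1), hlt (0 + 2)]
  choose k hk using hface
  have hm' : (0 : ℝ) < m := by exact_mod_cast hm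
  refine ⟨fun x => (k x, decide (0 ≤ x.1 (k x)), ⌊(m : ℝ) * x.1 (k x + 1)⌋,
    ⌊(m : ℝ) * x.1 (k x + 2)⌋), univ ×ˢ univ ×ˢ Icc (-(m : ℤ)) m ×ˢ Icc (-(m : ℤ)) m,
    fun x => ?_, ?_, fun x y hxy => ?_⟩
  · simp only [mem_product, mem_univ, true_and]
    have h := hsq x (k x)
    exact ⟨floor_mul_mem_Icc (by nlinarith), floor_mul_mem_Icc (by nlinarith)⟩
  · have hcard : #(Icc (-(m : ℤ)) m) = 2 * m + 1 := by
      rw [Int.card_Icc]; lia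
    simp only [card_product, hcard, card_univ, Fintype.card_fin, Fintype.card_bool]
    nlinarith
  · simp only [Prod.mk.injEq, decide_eq_decide] at hxy
    obtain ⟨hkk, hsign, hx, hy⟩ := hxy
    rw [← hkk] at hsign hx hy
    have hky := hk y
    rw [← hkk] at hky
    have h := sq_add_sq_add_sq_le_of_abs_sub_le (hsq x (k x)) (hsq y (k x)) (hk x) hky hsign
      (abs_sub_le_of_floor_mul_eq hm' hx) (abs_sub_le_of_floor_mul_eq hm' hy)
    rw [norm_sq_eq_cyclic _ (k x)]
    simpa [div_eq_mul_inv] using h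

/-- Among `n ≥ 2` points of the unit sphere at least `n` ordered pairs are at distance
`O(n ^ (-1 / 2))`. -/
lemma exists_many_close_pairs {n : ℕ} (hn : 2 ≤ n)
    (p : Fin n → sphere (0 : EuclideanSpace ℝ (Fin 3)) 1) :
    ∃ S ⊆ (univ : Finset (Fin n)).offDiag, n ≤ #S ∧ ∀ ij ∈ S,
      ‖(p ij.1 : EuclideanSpace ℝ (Fin 3)) - p ij.2‖ ^ 2 ≤ 7776 / n := by
  have hn' : (0 : ℝ) < n := by exact_mod_cast (by lia : 0 < n)
  rcases lt_or_ge n 108 with hsmall | hlarge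
  · refine ⟨_, Subset.rfl, ?_, fun ij _ => ?_⟩
    · rw [offDiag_card, card_univ, Fintype.card_fin]
      exact Nat.le_sub_of_add_le (by nlinarith)
    · have hdist : ‖(p ij.1 : EuclideanSpace ℝ (Fin 3)) - p ij.2‖ ≤ 2 := by
        refine (norm_sub_le _ _).trans ?_
        rw [norm_eq_of_mem_sphere, norm_eq_of_mem_sphere]
        norm_num
      have hn'' : (n : ℝ) < 108 := by exact_mod_cast hsmall
      rw [le_div_iff₀ hn']
      have := pow_le_pow_left₀ (norm_nonneg _) hdist 2
      nlinarith
  · obtain ⟨m, hm⟩ : ∃ m, m = Nat.sqrt (n / 108) := ⟨_, rfl⟩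
    have hle : 108 * m ^ 2 ≤ n := by
      have := Nat.sqrt_le' (n / 108)
      rw [← hm] at this
      lia
    have hlt : n < 108 * (m + 1) ^ 2 := by
      have := Nat.lt_succ_sqrt' (n / 108)
      rw [← hm, Nat.succ_eq_add_one] at this
      lia
    have hpos : 0 < m := by
      rw [hm, Nat.sqrt_pos]
      lia
    obtain ⟨f, T, hfT, hT, hf⟩ := exists_sphere_cells m hpos
    refine ⟨_, filter_subset (fun ij => f (p ij.1) = f (p ij.2)) _, ?_, fun ij hij => ?_⟩
    · have := card_le_card_offDiag_filter_eq (f ∘ p) T (fun i => hfT _)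
        (by rw [Fintype.card_fin]; lia)
      simpa using this
    · refine (hf _ _ (mem_filter.1 hij).2).trans ?_
      have hm' : (0 : ℝ) < m := by exact_mod_cast hpos
      rw [div_le_div_iff₀ (by positivity) hn']
      have : n ≤ 432 * m ^ 2 := by nlinarith
      have : (n : ℝ) ≤ 432 * m ^ 2 := by exact_mod_cast this
      linarith

/-- For every `s > 2` there is `c_s > 0` such that for any `n ≥ 2`
pairwise distinct points `p₁, …, pₙ` on the unit sphere in `ℝ³`,
`∑_{i ≠ j} ‖pᵢ - pⱼ‖⁻ˢ ≥ c_s n^{1+s/2}`. -/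
theorem riesz_energy_lower_bound_large_s (s : ℝ) (hs : 2 < s) :
    ∃ c : ℝ, 0 < c ∧ ∀ n : ℕ, 2 ≤ n →
      ∀ p : Fin n → sphere (0 : EuclideanSpace ℝ (Fin 3)) 1,
        Function.Injective p →
        c * (n : ℝ) ^ ((1 : ℝ) + s / 2) ≤
          ∑ ij ∈ (Finset.univ : Finset (Fin n)).offDiag,
            ‖(p ij.1 : EuclideanSpace ℝ (Fin 3)) - (p ij.2 : EuclideanSpace ℝ (Fin 3))‖ ^ (-s) := by
  refine ⟨7776 ^ (-(s / 2)), by positivity, fun n hn p hp => ?_⟩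
  have hn' : (0 : ℝ) < n := by exact_mod_cast (by lia : 0 < n)
  obtain ⟨S, hS, hcard, hclose⟩ := exists_many_close_pairs hn p
  have hterm : ∀ ij ∈ S, (7776 / n : ℝ) ^ (-(s / 2)) ≤
      ‖(p ij.1 : EuclideanSpace ℝ (Fin 3)) - p ij.2‖ ^ (-s) := by
    intro ij hij
    have hne : (p ij.1 : EuclideanSpace ℝ (Fin 3)) ≠ p ij.2 := fun h =>
      (mem_offDiag.1 (hS hij)).2.2 (hp (Subtype.ext h))
    have hpos := norm_pos_iff.2 (sub_ne_zero.2 hne)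
    calc (7776 / n : ℝ) ^ (-(s / 2))
        ≤ (‖(p ij.1 : EuclideanSpace ℝ (Fin 3)) - p ij.2‖ ^ 2) ^ (-(s / 2)) :=
          Real.rpow_le_rpow_of_nonpos (by positivity) (hclose ij hij) (by linarith)
      _ = ‖(p ij.1 : EuclideanSpace ℝ (Fin 3)) - p ij.2‖ ^ (-s) := by
          rw [← Real.rpow_natCast_mul hpos.le]
          congr 1
          push_cast
          ring
  calc (7776 : ℝ) ^ (-(s / 2)) * (n : ℝ) ^ (1 + s / 2)
      = n * (7776 / n : ℝ) ^ (-(s / 2)) := by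
        rw [Real.div_rpow (by norm_num) hn'.le, Real.rpow_neg hn'.le, div_inv_eq_mul,
          Real.rpow_add hn', Real.rpow_one]
        ring
    _ ≤ #S * (7776 / n : ℝ) ^ (-(s / 2)) := by gcongr
    _ ≤ ∑ ij ∈ S, ‖(p ij.1 : EuclideanSpace ℝ (Fin 3)) - p ij.2‖ ^ (-s) := by
        rw [← nsmul_eq_mul]
        exact card_nsmul_le_sum _ _ _ hterm
    _ ≤ _ := sum_le_sum_of_subset_of_nonneg hS fun _ _ _ => by positivity
end
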